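/- arXiv:1412.4014 — 6 statements merged into one kernel-verified Lean document; each statement's English description precedes it below -/
import Mathlib

section
/- Let K be a field and q ∈ K with q ≠ 0 and q ≠ 1. Let ∂_q be the K-linear operator on the Laurent polynomial ring K[x,x⁻¹] determined by ∂_q(x^l) = [l]_q x^{l−1} for all l ∈ ℤ, and for k ∈ ℤ let e_k be the K-linear operator on K[x,x⁻¹] given by e_k(f) = x^{k+1}·∂_q(f). Then for all m, n ∈ ℤ the operator identity q^{m+1}·e_m ∘ e_n − q^{n+1}·e_n ∘ e_m = ([n+1]_q − [m+1]_q)·e_{m+n} holds on K[x,x⁻¹]. -/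
open LaurentPolynomial

/-- The q-integer `[n]_q = (q^n - 1)/(q - 1)` for `n : ℤ`. -/
noncomputable def qInt {K : Type*} [Field K] (q : K) (n : ℤ) : K := (q ^ n - 1) / (q - 1)

/-- The q-integer identity underlying the relations of the q-Witt algebra. -/
theorem qInt_witt_identity {K : Type*} [Field K] {q : K} (hq0 : q ≠ 0) (m n l : ℤ) :
    q ^ (m + 1) * qInt q (l + n) - q ^ (n + 1) * qInt q (l + m)
      = qInt q (n + 1) - qInt q (m + 1) := by
  simp only [qInt, zpow_add₀ hq0]
  ring

/-- The operators `e_k = x^{k+1} ∂_q` on Laurent polynomials satisfy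
`q^{m+1} e_m ∘ e_n − q^{n+1} e_n ∘ e_m = ([n+1]_q − [m+1]_q) e_{m+n}`. -/
theorem qWitt_relations (K : Type*) [Field K] (q : K) (hq0 : q ≠ 0) (hq1 : q ≠ 1)
    (D : LaurentPolynomial K →ₗ[K] LaurentPolynomial K)
    (hD : ∀ l : ℤ, D (T l) = qInt q l • T (l - 1))
    (e : ℤ → (LaurentPolynomial K →ₗ[K] LaurentPolynomial K))
    (he : ∀ (k : ℤ) (f : LaurentPolynomial K), e k f = T (k + 1) * D f) :
    ∀ (m n : ℤ) (f : LaurentPolynomial K),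
      q ^ (m + 1) • e m (e n f) - q ^ (n + 1) • e n (e m f)
        = (qInt q (n + 1) - qInt q (m + 1)) • e (m + n) f := by
  have he_T (k l : ℤ) : e k (T l) = qInt q l • T (l + k) := by
    rw [he, hD, mul_smul_comm, ← T_add]
    congr 2
    ring
  intro m n f
  induction f using LaurentPolynomial.induction_on' with
  | add f g hf hg =>
    simp only [map_add, smul_add, ← hf, ← hg]
    abel
  | C_mul_T l a =>
    rw [← smul_eq_C_mul]
    simp only [map_smul, he_T, smul_smul]
    rw [show l + n + m = l + (m + n) by ring, show l + m + n = l + (m + n) by ring,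
      ← sub_smul, ← qInt_witt_identity hq0 m n l]
    congr 1
    ring
end

section
/- Let K be a field and q ∈ K with q ≠ 0 and q ≠ 1. Then for all integers k, l, m the following 'q-Jacobi relation' holds in K: (1 + q^k)·([m+1]_q − [l+1]_q)·([l+m+1]_q − [k+1]_q) + (1 + q^l)·([k+1]_q − [m+1]_q)·([m+k+1]_q − [l+1]_q) + (1 + q^m)·([l+1]_q − [k+1]_q)·([k+l+1]_q − [m+1]_q) = 0. (This is the coefficient form of the q-Jacobi relation (1+q^k)[e_k,[e_l,e_m]] + (1+q^l)[e_l,[e_m,e_k]] + (1+q^m)[e_m,[e_k,e_l]] = 0 for the q-Lie bracket [e_m, e_n] = ([n+1]_q − [m+1]_q)·e_{m+n} of the q-Witt algebra.) -/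
/-- The q-Jacobi relation for the q-Witt algebra, in coefficient form. -/
theorem qJacobi (K : Type*) [Field K] (q : K) (hq0 : q ≠ 0) (hq1 : q ≠ 1) (k l m : ℤ) :
    (1 + q ^ k) * (qInt q (m + 1) - qInt q (l + 1)) * (qInt q (l + m + 1) - qInt q (k + 1))
      + (1 + q ^ l) * (qInt q (k + 1) - qInt q (m + 1)) * (qInt q (m + k + 1) - qInt q (l + 1))
      + (1 + q ^ m) * (qInt q (l + 1) - qInt q (k + 1)) * (qInt q (k + l + 1) - qInt q (m + 1))
      = 0 := by
  have qInt_sub (a b : ℤ) : qInt q (a + 1) - qInt q (b + 1) = q / (q - 1) * (q ^ a - q ^ b) := by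
    simp only [qInt, zpow_add_one₀ hq0]
    ring
  simp only [qInt_sub, zpow_add₀ hq0]
  ring
end

section
/- Let h ∈ ℝ, h ≠ 0, and let F be the ℂ-vector space of all functions ℝ → ℂ. For k ∈ ℤ define the operator e_k : F → F by e_k(f)(x) = exp(ikx)·(f(x+h) − f(x))/h. Then for all k, l ∈ ℤ the operator identity exp(ikh)·e_k ∘ e_l − exp(ilh)·e_l ∘ e_k = ((exp(ilh) − exp(ikh))/h)·e_{k+l} holds on F. -/
/-- The generators `e_k = exp(ikx)·∂_h` of the h-Witt algebra, acting on functions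
`ℝ → ℂ`. -/
noncomputable def hWittGen (h : ℝ) (k : ℤ) (f : ℝ → ℂ) : ℝ → ℂ :=
  fun x => Complex.exp (Complex.I * (k : ℂ) * (x : ℂ)) * ((f (x + h) - f x) / (h : ℂ))

/-- The relations `exp(ikh)·e_k ∘ e_l − exp(ilh)·e_l ∘ e_k = ((exp(ilh) − exp(ikh))/h)·e_{k+l}`
of the h-Witt algebra. -/
theorem hWitt_relations (h : ℝ) (hh : h ≠ 0) :
    ∀ (k l : ℤ) (f : ℝ → ℂ),
      Complex.exp (Complex.I * (k : ℂ) * (h : ℂ)) • hWittGen h k (hWittGen h l f)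
        - Complex.exp (Complex.I * (l : ℂ) * (h : ℂ)) • hWittGen h l (hWittGen h k f)
        = ((Complex.exp (Complex.I * (l : ℂ) * (h : ℂ))
            - Complex.exp (Complex.I * (k : ℂ) * (h : ℂ))) / (h : ℂ)) • hWittGen h (k + l) f := by
  intro k l f
  have hc : (h : ℂ) ≠ 0 := Complex.ofReal_ne_zero.mpr hh
  funext x
  simp only [hWittGen, Pi.sub_apply, Pi.smul_apply, smul_eq_mul, Complex.ofReal_add,
    Int.cast_add, mul_add, add_mul, Complex.exp_add]
  field_simp
  ring
end

section
/- Let K be a field, q ∈ K with q ≠ 0. Let U := (ℤ →₀ K) be the free K-module with basis (e_k)_{k∈ℤ}, and let I ⊆ U ⊗ U be the K-span of the elements q^{k+1}·(e_k ⊗ e_l) − q^{l+1}·(e_l ⊗ e_k) for all k, l ∈ ℤ. Suppose k, l, m ∈ ℤ satisfy q^k ≠ 1, q^{l+1} ≠ q^{m+1}, and l + m ≠ k. Then the element q^{l+1}·q^{m+1}·([m+1]_q − [l+1]_q)·(e_{l+m} ⊗ e_k) − q^{2(k+1)}·([m+1]_q − [l+1]_q)·(e_k ⊗ e_{l+m})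 does NOT belong to I. (Consequently the first Jacobi condition of Polishchuk–Positselski fails for the q-Witt bracket, so the PBW property fails for the enveloping algebra of the q-Witt algebra.) -/
open TensorProduct

/-- The linear functional on `U ⊗ U` with `e_i ⊗ e_j ↦ q^{j+1}`, which annihilates the quadratic
relations. -/
noncomputable def qWittFunctional {K : Type*} [Field K] (q : K) :
    TensorProduct K (ℤ →₀ K) (ℤ →₀ K) →ₗ[K] K :=
  LinearMap.mul' K K ∘ₗ TensorProduct.map (Finsupp.linearCombination K fun _ => (1 : K))
    (Finsupp.linearCombination K fun j : ℤ => q ^ (j + 1))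

theorem qWittFunctional_single_tmul_single {K : Type*} [Field K] (q : K) (i j : ℤ) :
    qWittFunctional q (Finsupp.single i 1 ⊗ₜ[K] Finsupp.single j 1) = q ^ (j + 1) := by
  simp [qWittFunctional]

theorem zpow_eq_zpow_of_qInt_eq {K : Type*} [Field K] {q : K} {m n : ℤ} (hq : q ≠ 1)
    (h : qInt q m = qInt q n) : q ^ m = q ^ n := by
  have hsub : q - 1 ≠ 0 := sub_ne_zero.mpr hq
  simpa [qInt, div_left_inj' hsub] using h

/-- Failure of the first Polishchuk–Positselski Jacobi condition for the q-Witt bracket: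
the element
`q^{l+1} q^{m+1} ([m+1]_q − [l+1]_q)·(e_{l+m} ⊗ e_k) − q^{2(k+1)} ([m+1]_q − [l+1]_q)·(e_k ⊗ e_{l+m})`
does not belong to the span `I` of the quadratic relations
`q^{i+1}·(e_i ⊗ e_j) − q^{j+1}·(e_j ⊗ e_i)`. -/
theorem qWitt_jacobi_fails (K : Type*) [Field K] (q : K) (hq0 : q ≠ 0)
    (k l m : ℤ) (hk : q ^ k ≠ 1) (hlm : q ^ (l + 1) ≠ q ^ (m + 1)) (hklm : l + m ≠ k)
    (e : ℤ → (ℤ →₀ K)) (he : ∀ i : ℤ, e i = Finsupp.single i 1)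
    (I : Submodule K (TensorProduct K (ℤ →₀ K) (ℤ →₀ K)))
    (hI : I = Submodule.span K
      {v | ∃ i j : ℤ, v = q ^ (i + 1) • (e i ⊗ₜ[K] e j) - q ^ (j + 1) • (e j ⊗ₜ[K] e i)}) :
    (q ^ (l + 1) * q ^ (m + 1) * (qInt q (m + 1) - qInt q (l + 1))) • (e (l + m) ⊗ₜ[K] e k)
      - (q ^ (2 * (k + 1)) * (qInt q (m + 1) - qInt q (l + 1))) • (e k ⊗ₜ[K] e (l + m)) ∉ I := by
  intro hmem
  have hq1 : q ≠ 1 := by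
    rintro rfl
    simp at hk
  have hI_le : I ≤ LinearMap.ker (qWittFunctional q) := by
    rw [hI, Submodule.span_le]
    rintro _ ⟨i, j, rfl⟩
    simp [he, qWittFunctional_single_tmul_single, mul_comm]
  have hc : qInt q (m + 1) - qInt q (l + 1) ≠ 0 := fun h =>
    hlm (zpow_eq_zpow_of_qInt_eq hq1 (sub_eq_zero.mp h)).symm
  have hzero := LinearMap.mem_ker.mp (hI_le hmem)
  simp only [map_sub, map_smul, he, qWittFunctional_single_tmul_single, smul_eq_mul] at hzero
  have hleft : q ^ (l + 1) * q ^ (m + 1) * q ^ (k + 1) = q ^ (k + l + m + 3) := by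
    rw [← zpow_add₀ hq0, ← zpow_add₀ hq0]
    congr 1
    ring
  have hright : q ^ (2 * (k + 1)) * q ^ (l + m + 1) = q ^ (k + l + m + 3) * q ^ k := by
    rw [← zpow_add₀ hq0, ← zpow_add₀ hq0]
    congr 1
    ring
  have hprod : (qInt q (m + 1) - qInt q (l + 1)) * q ^ (k + l + m + 3) * (1 - q ^ k) = 0 := by
    linear_combination hzero - (qInt q (m + 1) - qInt q (l + 1)) * (hleft - hright)
  exact mul_ne_zero (mul_ne_zero hc (zpow_ne_zero _ hq0)) (sub_ne_zero.mpr hk.symm) hprod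
end

section
/- Let K be a field and a, c, k, m ∈ K with a ≠ 0 and c ≠ 0. Let A be the quotient of the free associative K-algebra on generators x, y, z by the two-sided ideal generated by the three elements x·y − a·y·x − k·x, y·z − a·z·y − k·z, and z·x − c·x·z − m·y. Then the images in A of the ordered monomials x^α y^β z^γ (α, β, γ ≥ 0) form a K-basis of A (the PBW property holds for A). -/
/-- The defining relations `xy = a yx + kx`, `yz = a zy + kz`, `zx = c xz + my` of the
`sl(2)`-like quadratic-linear algebra. -/
inductive SL2LikeRel (K : Type*) [Field K] (a c k m : K) :
    FreeAlgebra K (Fin 3) → FreeAlgebra K (Fin 3) → Prop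
  | xy : SL2LikeRel K a c k m (FreeAlgebra.ι K 0 * FreeAlgebra.ι K 1)
      (a • (FreeAlgebra.ι K 1 * FreeAlgebra.ι K 0) + k • FreeAlgebra.ι K 0)
  | yz : SL2LikeRel K a c k m (FreeAlgebra.ι K 1 * FreeAlgebra.ι K 2)
      (a • (FreeAlgebra.ι K 2 * FreeAlgebra.ι K 1) + k • FreeAlgebra.ι K 2)
  | zx : SL2LikeRel K a c k m (FreeAlgebra.ι K 2 * FreeAlgebra.ι K 0)
      (c • (FreeAlgebra.ι K 0 * FreeAlgebra.ι K 2) + m • FreeAlgebra.ι K 1)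

namespace SL2Like

open Polynomial

variable {K : Type*} [Field K]

/-- The substitution `y ↦ a⁻¹ (y - k)`, which describes commuting `y` past `x` or `z`. -/
noncomputable def twist (a k : K) : K[X] →ₐ[K] K[X] :=
  aeval (C a⁻¹ * (X - C k))

/-- The polynomials `s i` with `y * x ^ i = x ^ i * s i (y)`. -/
noncomputable def yCoeff (a k : K) : ℕ → K[X]
  | 0 => X
  | i + 1 => twist a k (yCoeff a k i)

/-- The polynomials `h i` with `z * x ^ (i + 1) = c ^ (i + 1) x ^ (i + 1) z + x ^ i h (i + 1) (y)`,
and `h 0 = 0`. -/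
noncomputable def zCoeff (a c k m : K) : ℕ → K[X]
  | 0 => 0
  | i + 1 => C c * zCoeff a c k m i + C m * yCoeff a k i

lemma twist_X (a k : K) : twist a k X = C a⁻¹ * (X - C k) := by simp [twist]

lemma yCoeff_eq {a : K} (ha : a ≠ 0) (k : K) (i : ℕ) :
    yCoeff a k i = C a * yCoeff a k (i + 1) + C k := by
  induction i with
  | zero =>
    have h : (C a : K[X]) * C a⁻¹ = 1 := by rw [← C_mul, mul_inv_cancel₀ ha, C_1]
    simp only [yCoeff, twist_X]
    linear_combination (C k - X) * h
  | succ i ih =>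
    have hC (r : K) : twist a k (C r) = C r := (twist a k).commutes r
    have := congrArg (twist a k) ih
    rwa [map_add, map_mul, hC, hC] at this

/-- Left multiplication by `z` on the polynomials in `y` and `z`, `z` being the outer variable. -/
noncomputable def zMul (a k : K) : K[X][X] →ₗ[K] K[X][X] :=
  LinearMap.mulLeft K X ∘ₗ (mapAlgHom (twist a k)).toLinearMap

lemma zMul_C_mul (a k : K) (p : K[X]) (w : K[X][X]) :
    zMul a k (C p * w) = C (twist a k p) * zMul a k w := by
  simp [zMul, mul_left_comm]

lemma zMul_monomial_one (a k : K) (j : ℕ) :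
    zMul a k (monomial j 1) = monomial (j + 1) 1 := by
  simp [zMul, X_mul_monomial]

/-- The action of `x` on the normal forms `∑ x ^ i w i (y, z)`. -/
noncomputable def xOp : Module.End K (ℕ →₀ K[X][X]) :=
  Finsupp.lsum ℕ fun i => Finsupp.lsingle (i + 1)

/-- The action of `y` on the normal forms `∑ x ^ i w i (y, z)`. -/
noncomputable def yOp (a k : K) : Module.End K (ℕ →₀ K[X][X]) :=
  Finsupp.lsum ℕ fun i => Finsupp.lsingle i ∘ₗ LinearMap.mulLeft K (C (yCoeff a k i))

/-- The action of `z` on the normal forms `∑ x ^ i w i (y, z)`. -/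
noncomputable def zOp (a c k m : K) : Module.End K (ℕ →₀ K[X][X]) :=
  Finsupp.lsum ℕ fun i => c ^ i • (Finsupp.lsingle i ∘ₗ zMul a k) +
    Finsupp.lsingle (i - 1) ∘ₗ LinearMap.mulLeft K (C (zCoeff a c k m i))

lemma xOp_single (i : ℕ) (w : K[X][X]) :
    xOp (K := K) (Finsupp.single i w) = Finsupp.single (i + 1) w := by
  simp [xOp]

lemma yOp_single (a k : K) (i : ℕ) (w : K[X][X]) :
    yOp a k (Finsupp.single i w) = Finsupp.single i (C (yCoeff a k i) * w) := by
  simp [yOp]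

lemma zOp_single (a c k m : K) (i : ℕ) (w : K[X][X]) :
    zOp a c k m (Finsupp.single i w) = c ^ i • Finsupp.single i (zMul a k w) +
      Finsupp.single (i - 1) (C (zCoeff a c k m i) * w) := by
  simp [zOp]

lemma smul_eq_C_C_mul (r : K) (w : K[X][X]) : r • w = C (C r) * w := by
  rw [← Polynomial.smul_eq_C_mul, ← algebraMap_eq, algebraMap_smul]

lemma xOp_mul_yOp {a : K} (ha : a ≠ 0) (k : K) :
    xOp * yOp a k = a • (yOp a k * xOp) + k • xOp := by
  refine Finsupp.lhom_ext fun i w => ?_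
  simp only [Module.End.mul_apply, LinearMap.add_apply, LinearMap.smul_apply, yOp_single,
    xOp_single, Finsupp.smul_single, ← Finsupp.single_add, smul_eq_C_C_mul]
  rw [yCoeff_eq ha k i]
  simp only [C_add, C_mul]
  ring_nf

lemma yOp_mul_zOp {a : K} (ha : a ≠ 0) (c k m : K) :
    yOp a k * zOp a c k m = a • (zOp a c k m * yOp a k) + k • zOp a c k m := by
  refine Finsupp.lhom_ext fun i w => ?_
  simp only [Module.End.mul_apply, LinearMap.add_apply, LinearMap.smul_apply, yOp_single,
    zOp_single, map_add, map_smul, zMul_C_mul]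
  rw [← yCoeff]
  have h₁ : C (yCoeff a k i) * zMul a k w =
      a • (C (yCoeff a k (i + 1)) * zMul a k w) + k • zMul a k w := by
    rw [yCoeff_eq ha k i]
    simp only [C_add, C_mul, smul_eq_C_C_mul]
    ring
  have h₂ : C (yCoeff a k (i - 1)) * (C (zCoeff a c k m i) * w) =
      a • (C (zCoeff a c k m i) * (C (yCoeff a k i) * w)) + k • (C (zCoeff a c k m i) * w) := by
    cases i with
    | zero => simp [zCoeff]
    | succ i =>
      rw [Nat.add_sub_cancel, yCoeff_eq ha k i]
      simp only [C_add, C_mul, smul_eq_C_C_mul]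
      ring
  rw [h₁, h₂]
  simp only [Finsupp.single_add, ← Finsupp.smul_single]
  module

lemma zOp_mul_xOp (a c k m : K) :
    zOp a c k m * xOp = c • (xOp * zOp a c k m) + m • yOp a k := by
  refine Finsupp.lhom_ext fun i w => ?_
  simp only [Module.End.mul_apply, LinearMap.add_apply, LinearMap.smul_apply, yOp_single,
    zOp_single, xOp_single, map_add, map_smul, Nat.add_sub_cancel]
  have h₁ : C (zCoeff a c k m (i + 1)) * w =
      c • (C (zCoeff a c k m i) * w) + m • (C (yCoeff a k i) * w) := by
    simp only [zCoeff, C_add, C_mul, smul_eq_C_C_mul]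
    ring
  have h₂ : Finsupp.single (i - 1 + 1) (C (zCoeff a c k m i) * w) =
      Finsupp.single i (C (zCoeff a c k m i) * w) := by
    cases i with
    | zero => simp [zCoeff]
    | succ i => rfl
  rw [h₁, h₂]
  simp only [Finsupp.single_add, ← Finsupp.smul_single]
  module

/-- The representation of the `sl(2)`-like algebra on normal forms. -/
noncomputable def rep {a : K} (ha : a ≠ 0) (c k m : K) :
    RingQuot (SL2LikeRel K a c k m) →ₐ[K] Module.End K (ℕ →₀ K[X][X]) :=
  RingQuot.liftAlgHom K ⟨FreeAlgebra.lift K ![xOp, yOp a k, zOp a c k m], by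
    rintro _ _ (_ | _ | _)
    · simpa using xOp_mul_yOp ha k
    · simpa using yOp_mul_zOp ha c k m
    · simpa using zOp_mul_xOp a c k m⟩

lemma xOp_pow_single (n i : ℕ) (w : K[X][X]) :
    (xOp (K := K) ^ n) (Finsupp.single i w) = Finsupp.single (i + n) w := by
  induction n with
  | zero => simp
  | succ n ih => rw [pow_succ', Module.End.mul_apply, ih, xOp_single, add_assoc]

lemma yOp_pow_single_zero (a k : K) (n : ℕ) (w : K[X][X]) :
    (yOp a k ^ n) (Finsupp.single 0 w) = Finsupp.single 0 (C (X ^ n) * w) := by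
  induction n with
  | zero => simp
  | succ n ih =>
    rw [pow_succ', Module.End.mul_apply, ih, yOp_single, yCoeff, ← mul_assoc, ← C_mul, pow_succ']

lemma zOp_pow_single_zero (a c k m : K) (n : ℕ) :
    (zOp a c k m ^ n) (Finsupp.single 0 1) = Finsupp.single 0 (monomial n 1) := by
  induction n with
  | zero => simp
  | succ n ih =>
    rw [pow_succ', Module.End.mul_apply, ih, zOp_single, zMul_monomial_one]
    simp [zCoeff]

lemma rep_monomial_apply {a : K} (ha : a ≠ 0) (c k m : K) (i j l : ℕ) :
    rep ha c k m (RingQuot.mkAlgHom K (SL2LikeRel K a c k m) (FreeAlgebra.ι K 0) ^ i *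
        RingQuot.mkAlgHom K (SL2LikeRel K a c k m) (FreeAlgebra.ι K 1) ^ j *
        RingQuot.mkAlgHom K (SL2LikeRel K a c k m) (FreeAlgebra.ι K 2) ^ l)
      (Finsupp.single 0 1) = Finsupp.single i (C (X ^ j) * monomial l 1) := by
  have hgen (t : Fin 3) : rep ha c k m (RingQuot.mkAlgHom K _ (FreeAlgebra.ι K t)) =
      ![xOp, yOp a k, zOp a c k m] t := by simp [rep]
  rw [map_mul, map_mul, map_pow, map_pow, map_pow, hgen, hgen, hgen]
  change (xOp ^ i) ((yOp a k ^ j) ((zOp a c k m ^ l) _)) = _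
  rw [zOp_pow_single_zero, yOp_pow_single_zero, xOp_pow_single, zero_add]

/-- The coefficients of a normal form. -/
noncomputable def coeffs : (ℕ →₀ K[X][X]) →ₗ[K] (ℕ × ℕ × ℕ → K) :=
  LinearMap.pi fun q => lcoeff K q.2.1 ∘ₗ (lcoeff K[X] q.2.2).restrictScalars K ∘ₗ
    Finsupp.lapply q.1

lemma coeffs_single (p : ℕ × ℕ × ℕ) :
    coeffs (K := K) (Finsupp.single p.1 (C (X ^ p.2.1) * monomial p.2.2 1)) = Pi.single p 1 := by
  obtain ⟨i, j, l⟩ := p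
  ext ⟨i', j', l'⟩
  by_cases hi : i = i' <;> by_cases hl : l = l' <;> by_cases hj : j' = j <;>
    simp_all [coeffs, C_mul_monomial, coeff_monomial, coeff_X_pow, eq_comm,
      -map_pow]

section Spanning

variable {A : Type*} [Ring A] [Algebra K A] {a c k m : K} {x y z : A}

lemma semiconjBy_aeval {u v : A} (h : SemiconjBy z u v) (p : K[X]) :
    SemiconjBy z (aeval u p) (aeval v p) := by
  induction p using Polynomial.induction_on' with
  | add p q hp hq => simpa only [map_add] using hp.add_right hq
  | monomial n r =>
    simp only [aeval_monomial]
    exact SemiconjBy.mul_right (Algebra.commutes r z).symm (h.pow_right n)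

lemma aeval_twist (p : K[X]) : aeval y (twist a k p) = aeval (a⁻¹ • (y - algebraMap K A k)) p := by
  rw [twist, ← aeval_algHom_apply]
  simp [Algebra.smul_def]

lemma z_mul_aeval (ha : a ≠ 0) (hyz : y * z = a • (z * y) + k • z) (p : K[X]) :
    z * aeval y p = aeval y (twist a k p) * z := by
  rw [aeval_twist]
  refine semiconjBy_aeval (?_ : z * y = _) p
  rw [smul_mul_assoc, sub_mul, hyz, ← Algebra.smul_def, add_sub_cancel_right, inv_smul_smul₀ ha]

lemma aeval_mul_x (ha : a ≠ 0) (hxy : x * y = a • (y * x) + k • x) (p : K[X]) :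
    aeval y p * x = x * aeval y (twist a k p) := by
  rw [aeval_twist]
  refine (semiconjBy_aeval (?_ : x * _ = y * x) p).symm
  rw [mul_smul_comm, mul_sub, hxy, ← Algebra.commutes, ← Algebra.smul_def, add_sub_cancel_right,
    inv_smul_smul₀ ha]

lemma y_mul_x_pow (ha : a ≠ 0) (hxy : x * y = a • (y * x) + k • x) (i : ℕ) :
    y * x ^ i = x ^ i * aeval y (yCoeff a k i) := by
  induction i with
  | zero => simp [yCoeff]
  | succ i ih =>
    rw [pow_succ, ← mul_assoc, ih, mul_assoc, aeval_mul_x ha hxy, ← mul_assoc, yCoeff]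

lemma z_mul_x_pow (ha : a ≠ 0) (hxy : x * y = a • (y * x) + k • x)
    (hzx : z * x = c • (x * z) + m • y) (i : ℕ) :
    z * x ^ i = c ^ i • (x ^ i * z) + x ^ (i - 1) * aeval y (zCoeff a c k m i) := by
  induction i with
  | zero => simp [zCoeff]
  | succ i ih =>
    have h : x * (x ^ (i - 1) * aeval y (zCoeff a c k m i)) =
        x ^ i * aeval y (zCoeff a c k m i) := by
      cases i with
      | zero => simp [zCoeff]
      | succ i => rw [← mul_assoc, ← pow_succ', Nat.add_sub_cancel]
    rw [pow_succ', ← mul_assoc, hzx, add_mul, smul_mul_assoc, mul_assoc, ih, smul_mul_assoc,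
      y_mul_x_pow ha hxy, mul_add, h, zCoeff]
    simp only [map_add, map_mul, aeval_C, ← Algebra.smul_def, mul_add, mul_smul_comm,
      Nat.add_sub_cancel, ← mul_assoc]
    module

variable (K x y z) in
/-- The span of the ordered monomials. -/
def monomialSpan : Submodule K A :=
  Submodule.span K (Set.range fun p : ℕ × ℕ × ℕ => x ^ p.1 * y ^ p.2.1 * z ^ p.2.2)

lemma mul_aeval_mul_mem (i j : ℕ) (p : K[X]) :
    x ^ i * aeval y p * z ^ j ∈ monomialSpan K x y z := by
  induction p using Polynomial.induction_on' with
  | add p q hp hq => simpa only [map_add, mul_add, add_mul] using add_mem hp hq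
  | monomial n r =>
    rw [aeval_monomial, ← Algebra.smul_def, mul_smul_comm, smul_mul_assoc]
    exact Submodule.smul_mem _ _ (Submodule.subset_span ⟨(i, n, j), rfl⟩)

lemma monomialSpan_le_comap {t : A}
    (h : ∀ i n j, t * (x ^ i * y ^ n * z ^ j) ∈ monomialSpan K x y z) :
    monomialSpan K x y z ≤ (monomialSpan K x y z).comap (LinearMap.mulLeft K t) := by
  refine Submodule.span_le.2 ?_
  rintro _ ⟨⟨i, n, j⟩, rfl⟩
  exact h i n j

lemma monomialSpan_eq_top (ha : a ≠ 0) (hxy : x * y = a • (y * x) + k • x)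
    (hyz : y * z = a • (z * y) + k • z) (hzx : z * x = c • (x * z) + m • y)
    (hgen : Algebra.adjoin K {x, y, z} = ⊤) : monomialSpan K x y z = ⊤ := by
  have hx : ∀ i n j, x * (x ^ i * y ^ n * z ^ j) ∈ monomialSpan K x y z := fun i n j =>
    Submodule.subset_span ⟨(i + 1, n, j), by simp only [pow_succ', mul_assoc]⟩
  have hy : ∀ i n j, y * (x ^ i * y ^ n * z ^ j) ∈ monomialSpan K x y z := fun i n j => by
    have := mul_aeval_mul_mem (x := x) (y := y) (z := z) i j (yCoeff a k i * X ^ n)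
    rwa [map_mul, ← mul_assoc, ← y_mul_x_pow ha hxy, aeval_X_pow, mul_assoc, mul_assoc,
      ← mul_assoc (x ^ i)] at this
  have hz : ∀ i n j, z * (x ^ i * y ^ n * z ^ j) ∈ monomialSpan K x y z := fun i n j => by
    have h := z_mul_aeval ha hyz (X ^ n)
    rw [aeval_X_pow] at h
    rw [← mul_assoc, ← mul_assoc, z_mul_x_pow ha hxy hzx, add_mul, add_mul, smul_mul_assoc,
      smul_mul_assoc, mul_assoc (x ^ i), h, ← mul_assoc, mul_assoc _ z, ← pow_succ',
      mul_assoc (x ^ (i - 1)), ← aeval_X_pow (R := K) y, ← map_mul]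
    exact add_mem (Submodule.smul_mem _ _ (mul_aeval_mul_mem i (j + 1) _))
      (mul_aeval_mul_mem (i - 1) j _)
  have hmul (t : A) : monomialSpan K x y z ≤
      (monomialSpan K x y z).comap (LinearMap.mulLeft K t) := by
    have ht : t ∈ Algebra.adjoin K {x, y, z} := hgen ▸ Algebra.mem_top
    induction ht using Algebra.adjoin_induction with
    | mem t ht =>
      rcases ht with rfl | rfl | rfl
      exacts [monomialSpan_le_comap hx, monomialSpan_le_comap hy, monomialSpan_le_comap hz]
    | algebraMap r =>
      intro w hw
      simpa [← Algebra.smul_def] using Submodule.smul_mem _ r hw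
    | add t u _ _ ht hu =>
      intro w hw
      rw [Submodule.mem_comap, LinearMap.mulLeft_apply, add_mul]
      exact add_mem (Submodule.mem_comap.1 (ht hw)) (Submodule.mem_comap.1 (hu hw))
    | mul t u _ _ ht hu =>
      intro w hw
      simpa [mul_assoc] using ht (hu hw)
  have h1 : (1 : A) ∈ monomialSpan K x y z := Submodule.subset_span ⟨(0, 0, 0), by simp⟩
  exact eq_top_iff.2 fun t _ => by simpa using hmul t h1

end Spanning

lemma adjoin_generators (a c k m : K) :
    Algebra.adjoin K {RingQuot.mkAlgHom K (SL2LikeRel K a c k m) (FreeAlgebra.ι K 0),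
      RingQuot.mkAlgHom K (SL2LikeRel K a c k m) (FreeAlgebra.ι K 1),
      RingQuot.mkAlgHom K (SL2LikeRel K a c k m) (FreeAlgebra.ι K 2)} = ⊤ := by
  have h := congrArg (Subalgebra.map (RingQuot.mkAlgHom K (SL2LikeRel K a c k m)))
    (FreeAlgebra.adjoin_range_ι K (Fin 3))
  rw [AlgHom.map_adjoin, Algebra.map_top,
    (AlgHom.range_eq_top _).2 (RingQuot.mkAlgHom_surjective K _)] at h
  rw [← h]
  congr 1
  ext t
  simp [Fin.exists_fin_succ, eq_comm]

end SL2Like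

/-- PBW property for the `sl(2)`-like algebra with relations
`xy − a yx = kx`, `yz − a zy = kz`, `zx − c xz = my` (`a, c ≠ 0`): the images of the
ordered monomials `x^α y^β z^γ` form a `K`-basis. -/
theorem sl2_like_pbw (K : Type*) [Field K] (a c k m : K) (ha : a ≠ 0) (hc : c ≠ 0)
    (mono : ℕ × ℕ × ℕ → RingQuot (SL2LikeRel K a c k m))
    (hmono : ∀ p : ℕ × ℕ × ℕ, mono p =
      RingQuot.mkAlgHom K (SL2LikeRel K a c k m) (FreeAlgebra.ι K 0) ^ p.1 *
      RingQuot.mkAlgHom K (SL2LikeRel K a c k m) (FreeAlgebra.ι K 1) ^ p.2.1 *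
      RingQuot.mkAlgHom K (SL2LikeRel K a c k m) (FreeAlgebra.ι K 2) ^ p.2.2) :
    LinearIndependent K mono ∧ Submodule.span K (Set.range mono) = ⊤ := by
  obtain rfl : mono = _ := funext hmono
  constructor
  · refine LinearIndependent.of_comp
      (SL2Like.coeffs ∘ₗ LinearMap.applyₗ (Finsupp.single 0 1) ∘ₗ (SL2Like.rep ha c k m).toLinearMap)
      ?_
    convert Pi.linearIndependent_single_one (ℕ × ℕ × ℕ) K with p
    rw [← SL2Like.coeffs_single, ← SL2Like.rep_monomial_apply ha c k m]
    rfl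
  · refine SL2Like.monomialSpan_eq_top (a := a) (c := c) (k := k) (m := m) ha ?_ ?_ ?_
      (SL2Like.adjoin_generators a c k m)
    · simpa using RingQuot.mkAlgHom_rel K (SL2LikeRel.xy (a := a) (c := c) (k := k) (m := m))
    · simpa using RingQuot.mkAlgHom_rel K (SL2LikeRel.yz (a := a) (c := c) (k := k) (m := m))
    · simpa using RingQuot.mkAlgHom_rel K (SL2LikeRel.zx (a := a) (c := c) (k := k) (m := m))
end

section
/- Let K be a field and a ∈ K with a ≠ 0. Let A be the quotient of the free associative K-algebra on generators x, y, z by the two-sided ideal generated by the three elements x·y − a·y·x − z, y·z − a·z·y − x, and z·x − a·x·z − y. Then the images in A of the ordered monomials x^α y^β z^γ (α, β, γ ≥ 0) form a K-basis of A (the PBW property holds, so A is a deformation of the symmetric algebra of a 3-dimensional space with the good deformation property). -/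
/-- The defining relations `xy = a yx + z`, `yz = a zy + x`, `zx = a xz + y` of the
`su(2)`-like quadratic-linear algebra. -/
inductive SU2LikeRel (K : Type*) [Field K] (a : K) :
    FreeAlgebra K (Fin 3) → FreeAlgebra K (Fin 3) → Prop
  | xy : SU2LikeRel K a (FreeAlgebra.ι K 0 * FreeAlgebra.ι K 1)
      (a • (FreeAlgebra.ι K 1 * FreeAlgebra.ι K 0) + FreeAlgebra.ι K 2)
  | yz : SU2LikeRel K a (FreeAlgebra.ι K 1 * FreeAlgebra.ι K 2)
      (a • (FreeAlgebra.ι K 2 * FreeAlgebra.ι K 1) + FreeAlgebra.ι K 0)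
  | zx : SU2LikeRel K a (FreeAlgebra.ι K 2 * FreeAlgebra.ι K 0)
      (a • (FreeAlgebra.ι K 0 * FreeAlgebra.ι K 2) + FreeAlgebra.ι K 1)

namespace SU2Like

open Finsupp

/-- The total degree of an exponent vector. -/
def deg (p : ℕ × ℕ × ℕ) : ℕ := p.1 + p.2.1 + p.2.2

section Model

variable {K : Type*} [Field K] (a : K)

/-- The vector space with basis indexed by the exponents of ordered monomials. -/
abbrev Model (K : Type*) [Field K] : Type _ := (ℕ × ℕ × ℕ) →₀ K

/-- The basis vector of the model corresponding to `x^α y^β z^γ`. -/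
noncomputable abbrev vec (K : Type*) [Field K] (p : ℕ × ℕ × ℕ) : Model K := single p 1

/-- The linear endomorphism with prescribed values on the basis vectors. -/
noncomputable abbrev ofValues (f : ℕ × ℕ × ℕ → Model K) : Module.End K (Model K) :=
  linearCombination K f

/-- Left multiplication by `x` on ordered monomials. -/
noncomputable def opX (K : Type*) [Field K] : Module.End K (Model K) :=
  ofValues fun p => vec K (p.1 + 1, p.2)

/-- The values of left multiplication by `y`, in terms of approximations `Y`, `Z` of left
multiplication by `y` and `z` in lower degrees. -/
noncomputable def valuesY (Y Z : Module.End K (Model K)) : ℕ × ℕ × ℕ → Model K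
  | (0, β, γ) => vec K (0, β + 1, γ)
  | (α + 1, β, γ) => a⁻¹ • opX K (Y (vec K (α, β, γ))) - a⁻¹ • Z (vec K (α, β, γ))

/-- The values of left multiplication by `z`, in terms of an approximation `Y'` of left
multiplication by `y` and approximations `Y`, `Z` in lower degrees. -/
noncomputable def valuesZ (Y' Y Z : Module.End K (Model K)) : ℕ × ℕ × ℕ → Model K
  | (0, 0, γ) => vec K (0, 0, γ + 1)
  | (0, β + 1, γ) => a⁻¹ • Y' (Z (vec K (0, β, γ))) - a⁻¹ • vec K (1, β, γ)
  | (α + 1, β, γ) => a • opX K (Z (vec K (α, β, γ))) + Y (vec K (α, β, γ))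

/-- Approximations of left multiplication by `y` and `z`, correct in degrees less than `n`. -/
noncomputable def approx : ℕ → Module.End K (Model K) × Module.End K (Model K)
  | 0 => (0, 0)
  | n + 1 =>
    let Y' := ofValues (valuesY a (approx n).1 (approx n).2)
    (Y', ofValues (valuesZ a Y' (approx n).1 (approx n).2))

/-- The vectors of degree less than `n`. -/
noncomputable def degLT (K : Type*) [Field K] (n : ℕ) : Submodule K (Model K) :=
  supported K K {p | deg p < n}

theorem degLT_mono {m n : ℕ} (h : m ≤ n) : degLT K m ≤ degLT K n :=
  supported_mono fun _ hp => lt_of_lt_of_le hp h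

theorem vec_mem_degLT {p : ℕ × ℕ × ℕ} {n : ℕ} (h : deg p < n) : vec K p ∈ degLT K n :=
  single_mem_supported K 1 h

theorem degLT_eq_span (n : ℕ) :
    degLT K n = Submodule.span K (vec K '' {p | deg p < n}) :=
  supported_eq_span_single K _

theorem map_mem_of_vec {n m : ℕ} {T : Module.End K (Model K)}
    (h : ∀ p, deg p < n → T (vec K p) ∈ degLT K m) {v : Model K} (hv : v ∈ degLT K n) :
    T v ∈ degLT K m := by
  have : degLT K n ≤ (degLT K m).comap T := by
    rw [degLT_eq_span n, Submodule.span_le]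
    rintro _ ⟨p, hp, rfl⟩
    exact h p hp
  exact this hv

theorem eq_of_eq_vec {n : ℕ} {S T : Module.End K (Model K)}
    (h : ∀ p, deg p < n → S (vec K p) = T (vec K p)) {v : Model K} (hv : v ∈ degLT K n) :
    S v = T v := by
  have : degLT K n ≤ LinearMap.eqLocus S T := by
    rw [degLT_eq_span n, Submodule.span_le]
    rintro _ ⟨p, hp, rfl⟩
    exact h p hp
  exact this hv

theorem ofValues_vec (f : ℕ × ℕ × ℕ → Model K) (p : ℕ × ℕ × ℕ) :
    ofValues f (vec K p) = f p := by
  simp [ofValues, vec]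

theorem opX_vec (p : ℕ × ℕ × ℕ) : opX K (vec K p) = vec K (p.1 + 1, p.2) :=
  ofValues_vec _ _

theorem opX_mem {n : ℕ} {v : Model K} (hv : v ∈ degLT K n) : opX K v ∈ degLT K (n + 1) := by
  refine map_mem_of_vec (fun p hp => ?_) hv
  rw [opX_vec]
  refine vec_mem_degLT ?_
  simp only [deg] at *
  omega

theorem approx_succ_fst_vec (n : ℕ) (p : ℕ × ℕ × ℕ) :
    (approx a (n + 1)).1 (vec K p) = valuesY a (approx a n).1 (approx a n).2 p :=
  ofValues_vec _ _

theorem approx_succ_snd_vec (n : ℕ) (p : ℕ × ℕ × ℕ) :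
    (approx a (n + 1)).2 (vec K p) =
      valuesZ a (approx a (n + 1)).1 (approx a n).1 (approx a n).2 p :=
  ofValues_vec _ _

theorem approx_mem (n : ℕ) : ∀ m ≤ n, ∀ p, deg p < m →
    (approx a n).1 (vec K p) ∈ degLT K (m + 1) ∧ (approx a n).2 (vec K p) ∈ degLT K (m + 1) := by
  induction n with
  | zero => intro m hm p hp; omega
  | succ n ih =>
    intro m hm p hp
    obtain ⟨m, rfl⟩ : ∃ k, m = k + 1 := ⟨m - 1, by omega⟩
    have hY : ∀ m ≤ n, ∀ p, deg p < m + 1 →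
        (approx a (n + 1)).1 (vec K p) ∈ degLT K (m + 2) := by
      rintro m hm ⟨_ | α, β, γ⟩ hp <;> rw [approx_succ_fst_vec]
      · refine vec_mem_degLT ?_
        simp only [deg] at *
        omega
      · have hq := ih m hm (α, β, γ) (by simp only [deg] at *; omega)
        exact sub_mem (Submodule.smul_mem _ _ (opX_mem hq.1))
          (Submodule.smul_mem _ _ (degLT_mono (by omega) hq.2))
    refine ⟨hY m (by omega) p hp, ?_⟩
    obtain ⟨_ | α, β, γ⟩ := p
    · obtain _ | β := β <;> rw [approx_succ_snd_vec]
      · refine vec_mem_degLT ?_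
        simp only [deg] at *
        omega
      · have hq := ih m (by omega) (0, β, γ) (by simp only [deg] at *; omega)
        refine sub_mem (Submodule.smul_mem _ _ (map_mem_of_vec (hY m (by omega)) hq.2))
          (Submodule.smul_mem _ _ (vec_mem_degLT ?_))
        simp only [deg] at *
        omega
    · rw [approx_succ_snd_vec]
      have hq := ih m (by omega) (α, β, γ) (by simp only [deg] at *; omega)
      exact add_mem (Submodule.smul_mem _ _ (opX_mem hq.2)) (degLT_mono (by omega) hq.1)

theorem approx_succ_eq (n : ℕ) : ∀ p, deg p < n →
    (approx a (n + 1)).1 (vec K p) = (approx a n).1 (vec K p) ∧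
      (approx a (n + 1)).2 (vec K p) = (approx a n).2 (vec K p) := by
  induction n with
  | zero => intro p hp; omega
  | succ n ih =>
    have hY : ∀ p, deg p < n + 1 →
        (approx a (n + 2)).1 (vec K p) = (approx a (n + 1)).1 (vec K p) := by
      rintro ⟨_ | α, β, γ⟩ hp <;> rw [approx_succ_fst_vec, approx_succ_fst_vec]
      · rfl
      · have hq := ih (α, β, γ) (by simp only [deg] at *; omega)
        simp only [valuesY, hq]
    intro p hp
    refine ⟨hY p hp, ?_⟩
    rw [approx_succ_snd_vec, approx_succ_snd_vec]
    obtain ⟨_ | α, β, γ⟩ := p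
    · obtain _ | β := β
      · rfl
      · have hlt : deg (0, β, γ) < n := by simp only [deg] at *; omega
        have hq := ih _ hlt
        simp only [valuesZ, hq, eq_of_eq_vec hY (approx_mem a n n le_rfl _ hlt).2]
    · have hq := ih (α, β, γ) (by simp only [deg] at *; omega)
      simp only [valuesZ, hq]

theorem approx_eq_of_le {m n : ℕ} (h : m ≤ n) (p : ℕ × ℕ × ℕ) (hp : deg p < m) :
    (approx a n).1 (vec K p) = (approx a m).1 (vec K p) ∧
      (approx a n).2 (vec K p) = (approx a m).2 (vec K p) := by
  induction n, h using Nat.le_induction with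
  | base => exact ⟨rfl, rfl⟩
  | succ n hmn ih =>
    have := approx_succ_eq a n p (by omega)
    exact ⟨this.1.trans ih.1, this.2.trans ih.2⟩

/-- Left multiplication by `y` on ordered monomials. -/
noncomputable def opY : Module.End K (Model K) :=
  ofValues fun p => (approx a (deg p + 1)).1 (vec K p)

/-- Left multiplication by `z` on ordered monomials. -/
noncomputable def opZ : Module.End K (Model K) :=
  ofValues fun p => (approx a (deg p + 1)).2 (vec K p)

theorem opY_vec_eq_approx {n : ℕ} {p : ℕ × ℕ × ℕ} (hp : deg p < n) :
    opY a (vec K p) = (approx a n).1 (vec K p) := by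
  rw [opY, ofValues_vec, (approx_eq_of_le a hp p (Nat.lt_succ_self _)).1]

theorem opZ_vec_eq_approx {n : ℕ} {p : ℕ × ℕ × ℕ} (hp : deg p < n) :
    opZ a (vec K p) = (approx a n).2 (vec K p) := by
  rw [opZ, ofValues_vec, (approx_eq_of_le a hp p (Nat.lt_succ_self _)).2]

theorem opY_vec (p : ℕ × ℕ × ℕ) : opY a (vec K p) = valuesY a (opY a) (opZ a) p := by
  rw [opY_vec_eq_approx a (Nat.lt_succ_self (deg p)), approx_succ_fst_vec]
  obtain ⟨_ | α, β, γ⟩ := p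
  · rfl
  · have hlt : deg (α, β, γ) < deg (α + 1, β, γ) := by simp only [deg]; omega
    simp only [valuesY, opY_vec_eq_approx a hlt, opZ_vec_eq_approx a hlt]

theorem opZ_vec (p : ℕ × ℕ × ℕ) : opZ a (vec K p) = valuesZ a (opY a) (opY a) (opZ a) p := by
  rw [opZ_vec_eq_approx a (Nat.lt_succ_self (deg p)), approx_succ_snd_vec]
  obtain ⟨_ | α, β, γ⟩ := p
  · obtain _ | β := β
    · rfl
    · have hlt : deg (0, β, γ) < deg (0, β + 1, γ) := by simp only [deg]; omega
      have hmem := (approx_mem a _ _ le_rfl _ hlt).2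
      simp only [valuesZ, opZ_vec_eq_approx a hlt,
        eq_of_eq_vec (fun q hq => opY_vec_eq_approx a hq) hmem]
  · have hlt : deg (α, β, γ) < deg (α + 1, β, γ) := by simp only [deg]; omega
    simp only [valuesZ, opY_vec_eq_approx a hlt, opZ_vec_eq_approx a hlt]

theorem opY_mul_opX : opY a * opX K = a⁻¹ • (opX K * opY a) - a⁻¹ • opZ a := by
  refine lhom_ext' fun p => LinearMap.ext_ring ?_
  change opY a (opX K (vec K p)) = a⁻¹ • opX K (opY a (vec K p)) - a⁻¹ • opZ a (vec K p)
  rw [opX_vec, opY_vec a (p.1 + 1, p.2)]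
  rfl

theorem opZ_mul_opX : opZ a * opX K = a • (opX K * opZ a) + opY a := by
  refine lhom_ext' fun p => LinearMap.ext_ring ?_
  change opZ a (opX K (vec K p)) = a • opX K (opZ a (vec K p)) + opY a (vec K p)
  rw [opX_vec, opZ_vec a (p.1 + 1, p.2)]
  rfl

theorem opZ_opY_vec (ha : a ≠ 0) (α β γ : ℕ) :
    a • opZ a (opY a (vec K (α, β, γ))) =
      opY a (opZ a (vec K (α, β, γ))) - opX K (vec K (α, β, γ)) := by
  have hYX (v : Model K) : opY a (opX K v) = a⁻¹ • opX K (opY a v) - a⁻¹ • opZ a v :=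
    LinearMap.congr_fun (opY_mul_opX a) v
  have hZX (v : Model K) : opZ a (opX K v) = a • opX K (opZ a v) + opY a v :=
    LinearMap.congr_fun (opZ_mul_opX a) v
  induction α with
  | zero =>
    rw [opY_vec a (0, β, γ), opX_vec]
    change a • opZ a (vec K (0, β + 1, γ)) = _
    rw [opZ_vec a (0, β + 1, γ)]
    simp only [valuesZ, smul_sub, smul_inv_smul₀ ha, zero_add]
  | succ α ih =>
    set v := vec K (α, β, γ)
    have hvec : vec K (α + 1, β, γ) = opX K v := (opX_vec (α, β, γ)).symm
    have hX := congrArg (opX K) ih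
    simp only [map_smul, map_sub] at hX
    rw [hvec, hYX, hZX]
    simp only [map_add, map_sub, map_smul, hYX, hZX, smul_sub, smul_add,
      smul_inv_smul₀ ha, hX]
    abel

theorem opX_mul_opY (ha : a ≠ 0) : opX K * opY a = a • (opY a * opX K) + opZ a := by
  refine LinearMap.ext fun v => ?_
  have h := LinearMap.congr_fun (opY_mul_opX a) v
  change opY a (opX K v) = a⁻¹ • opX K (opY a v) - a⁻¹ • opZ a v at h
  change opX K (opY a v) = a • opY a (opX K v) + opZ a v
  rw [h, smul_sub, smul_inv_smul₀ ha, smul_inv_smul₀ ha, sub_add_cancel]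

theorem opY_mul_opZ (ha : a ≠ 0) : opY a * opZ a = a • (opZ a * opY a) + opX K := by
  refine lhom_ext' fun p => LinearMap.ext_ring ?_
  exact sub_eq_iff_eq_add.1 (opZ_opY_vec a ha p.1 p.2.1 p.2.2).symm

/-- The action of the `su(2)`-like algebra on the span of ordered monomials. -/
noncomputable def rep (ha : a ≠ 0) :
    RingQuot (SU2LikeRel K a) →ₐ[K] Module.End K (Model K) :=
  RingQuot.liftAlgHom K ⟨FreeAlgebra.lift K ![opX K, opY a, opZ a], by
    rintro _ _ (_ | _ | _) <;>
      simp only [map_add, map_mul, map_smul, FreeAlgebra.lift_ι_apply, Matrix.cons_val]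
    · exact opX_mul_opY a ha
    · exact opY_mul_opZ a ha
    · exact opZ_mul_opX a⟩

theorem rep_ι (ha : a ≠ 0) (i : Fin 3) :
    rep a ha (RingQuot.mkAlgHom K (SU2LikeRel K a) (FreeAlgebra.ι K i)) =
      ![opX K, opY a, opZ a] i := by
  rw [rep, RingQuot.liftAlgHom_mkAlgHom_apply, FreeAlgebra.lift_ι_apply]

theorem opZ_pow_vec (γ : ℕ) : (opZ a ^ γ) (vec K (0, 0, 0)) = vec K (0, 0, γ) := by
  induction γ with
  | zero => rfl
  | succ γ ih => rw [pow_succ', Module.End.mul_apply, ih, opZ_vec]; rfl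

theorem opY_pow_vec (β γ : ℕ) : (opY a ^ β) (vec K (0, 0, γ)) = vec K (0, β, γ) := by
  induction β with
  | zero => rfl
  | succ β ih => rw [pow_succ', Module.End.mul_apply, ih, opY_vec]; rfl

theorem opX_pow_vec (α β γ : ℕ) : (opX K ^ α) (vec K (0, β, γ)) = vec K (α, β, γ) := by
  induction α with
  | zero => rfl
  | succ α ih => rw [pow_succ', Module.End.mul_apply, ih, opX_vec]

theorem linearIndependent_monomials (ha : a ≠ 0) :
    LinearIndependent K fun p : ℕ × ℕ × ℕ =>
      RingQuot.mkAlgHom K (SU2LikeRel K a) (FreeAlgebra.ι K 0) ^ p.1 *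
      RingQuot.mkAlgHom K (SU2LikeRel K a) (FreeAlgebra.ι K 1) ^ p.2.1 *
      RingQuot.mkAlgHom K (SU2LikeRel K a) (FreeAlgebra.ι K 2) ^ p.2.2 := by
  refine LinearIndependent.of_comp
    ((LinearMap.applyₗ (vec K (0, 0, 0))).comp (rep a ha).toLinearMap) ?_
  convert (Finsupp.basisSingleOne (R := K) (ι := ℕ × ℕ × ℕ)).linearIndependent using 1
  funext p
  simp only [Function.comp_apply, LinearMap.comp_apply, AlgHom.toLinearMap_apply,
    LinearMap.applyₗ_apply_apply, map_mul, map_pow, rep_ι, Matrix.cons_val,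
    Module.End.mul_apply, opZ_pow_vec, opY_pow_vec, opX_pow_vec, Finsupp.coe_basisSingleOne]

end Model

section Spanning

variable {K A : Type*} [Field K] [Ring A] [Algebra K A]

/-- The span of the ordered monomials `x^α y^β z^γ` of degree less than `n`. -/
def monomialSpan (K : Type*) {A : Type*} [Field K] [Ring A] [Algebra K A] (x y z : A) (n : ℕ) :
    Submodule K A :=
  Submodule.span K ((fun p : ℕ × ℕ × ℕ => x ^ p.1 * y ^ p.2.1 * z ^ p.2.2) '' {p | deg p < n})

variable {x y z : A}

theorem monomialSpan_mono {m n : ℕ} (h : m ≤ n) :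
    monomialSpan K x y z m ≤ monomialSpan K x y z n :=
  Submodule.span_mono (Set.image_mono fun _ hp => lt_of_lt_of_le hp h)

theorem monomial_mem_monomialSpan {n : ℕ} (α β γ : ℕ) (h : α + β + γ < n) :
    x ^ α * y ^ β * z ^ γ ∈ monomialSpan K x y z n :=
  Submodule.subset_span ⟨(α, β, γ), h, rfl⟩

theorem mul_mem_of_monomial {n : ℕ} {t : A} {S : Submodule K A}
    (h : ∀ α β γ, α + β + γ < n → t * (x ^ α * y ^ β * z ^ γ) ∈ S) {v : A}
    (hv : v ∈ monomialSpan K x y z n) : t * v ∈ S := by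
  have : monomialSpan K x y z n ≤ S.comap (LinearMap.mulLeft K t) := by
    rw [monomialSpan, Submodule.span_le]
    rintro _ ⟨p, hp, rfl⟩
    exact h p.1 p.2.1 p.2.2 hp
  exact this hv

theorem left_mul_mem_monomialSpan {n : ℕ} {v : A} (hv : v ∈ monomialSpan K x y z n) :
    x * v ∈ monomialSpan K x y z (n + 1) := by
  refine mul_mem_of_monomial (fun α β γ h => ?_) hv
  rw [← mul_assoc, ← mul_assoc, ← pow_succ']
  exact monomial_mem_monomialSpan _ _ _ (by omega)

variable {a b : K}

theorem mul_monomial_mem_monomialSpan (hyx : y * x = b • (x * y) - b • z)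
    (hzy : z * y = b • (y * z) - b • x) (hzx : z * x = a • (x * z) + y) (n : ℕ) :
    ∀ α β γ, α + β + γ < n →
      y * (x ^ α * y ^ β * z ^ γ) ∈ monomialSpan K x y z (n + 1) ∧
        z * (x ^ α * y ^ β * z ^ γ) ∈ monomialSpan K x y z (n + 1) := by
  induction n with
  | zero => intro α β γ h; omega
  | succ n ih =>
    have hy : ∀ α β γ, α + β + γ < n + 1 →
        y * (x ^ α * y ^ β * z ^ γ) ∈ monomialSpan K x y z (n + 2) := by
      rintro (_ | α) β γ h
      · convert monomial_mem_monomialSpan (K := K) (x := x) (y := y) (z := z) (n := n + 2)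
          0 (β + 1) γ (by omega) using 1
        simp only [pow_zero, one_mul, pow_succ', mul_assoc]
      · have hq := ih α β γ (by omega)
        have : y * (x ^ (α + 1) * y ^ β * z ^ γ) =
            b • (x * (y * (x ^ α * y ^ β * z ^ γ))) - b • (z * (x ^ α * y ^ β * z ^ γ)) := by
          calc _ = y * x * (x ^ α * y ^ β * z ^ γ) := by simp only [pow_succ', mul_assoc]
            _ = _ := by rw [hyx]; simp only [sub_mul, smul_mul_assoc, mul_assoc]
        rw [this]
        exact sub_mem (Submodule.smul_mem _ _ (left_mul_mem_monomialSpan hq.1))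
          (Submodule.smul_mem _ _ (monomialSpan_mono (by omega) hq.2))
    intro α β γ h
    refine ⟨hy α β γ h, ?_⟩
    obtain _ | α := α
    · obtain _ | β := β
      · convert monomial_mem_monomialSpan (K := K) (x := x) (y := y) (z := z) (n := n + 2)
          0 0 (γ + 1) (by omega) using 1
        simp only [pow_zero, one_mul, pow_succ']
      · have hq := ih 0 β γ (by omega)
        have : z * (x ^ 0 * y ^ (β + 1) * z ^ γ) =
            b • (y * (z * (x ^ 0 * y ^ β * z ^ γ))) - b • (x ^ 1 * y ^ β * z ^ γ) := by
          calc _ = z * y * (x ^ 0 * y ^ β * z ^ γ) := by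
                simp only [pow_zero, one_mul, pow_succ', mul_assoc]
            _ = _ := by
                rw [hzy]
                simp only [sub_mul, smul_mul_assoc, mul_assoc, pow_zero, one_mul, pow_one]
        rw [this]
        exact sub_mem (Submodule.smul_mem _ _ (mul_mem_of_monomial hy hq.2))
          (Submodule.smul_mem _ _ (monomial_mem_monomialSpan _ _ _ (by omega)))
    · have hq := ih α β γ (by omega)
      have : z * (x ^ (α + 1) * y ^ β * z ^ γ) =
          a • (x * (z * (x ^ α * y ^ β * z ^ γ))) + y * (x ^ α * y ^ β * z ^ γ) := by
        calc _ = z * x * (x ^ α * y ^ β * z ^ γ) := by simp only [pow_succ', mul_assoc]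
          _ = _ := by rw [hzx]; simp only [add_mul, smul_mul_assoc, mul_assoc]
      rw [this]
      exact add_mem (Submodule.smul_mem _ _ (left_mul_mem_monomialSpan hq.2))
        (monomialSpan_mono (by omega) hq.1)

theorem mul_mem_span_monomials (hyx : y * x = b • (x * y) - b • z)
    (hzy : z * y = b • (y * z) - b • x) (hzx : z * x = a • (x * z) + y)
    {t : A} (ht : t = x ∨ t = y ∨ t = z) {v : A}
    (hv : v ∈ Submodule.span K
      (Set.range fun p : ℕ × ℕ × ℕ => x ^ p.1 * y ^ p.2.1 * z ^ p.2.2)) :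
    t * v ∈ Submodule.span K
      (Set.range fun p : ℕ × ℕ × ℕ => x ^ p.1 * y ^ p.2.1 * z ^ p.2.2) := by
  have hle (n : ℕ) : monomialSpan K x y z n ≤ Submodule.span K
      (Set.range fun p : ℕ × ℕ × ℕ => x ^ p.1 * y ^ p.2.1 * z ^ p.2.2) :=
    Submodule.span_mono (Set.image_subset_range _ _)
  induction hv using Submodule.span_induction with
  | zero => rw [mul_zero]; exact zero_mem _
  | add u v _ _ hu hv => rw [mul_add]; exact add_mem hu hv
  | smul c v _ hv => rw [mul_smul_comm]; exact Submodule.smul_mem _ _ hv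
  | mem v hv =>
    obtain ⟨⟨α, β, γ⟩, rfl⟩ := hv
    have h := mul_monomial_mem_monomialSpan hyx hzy hzx _ α β γ (Nat.lt_succ_self _)
    rcases ht with rfl | rfl | rfl
    · exact hle _ (left_mul_mem_monomialSpan
        (monomial_mem_monomialSpan α β γ (Nat.lt_succ_self _)))
    · exact hle _ h.1
    · exact hle _ h.2

end Spanning

theorem span_monomials {K : Type*} [Field K] {a : K} (ha : a ≠ 0) :
    Submodule.span K (Set.range fun p : ℕ × ℕ × ℕ =>
      RingQuot.mkAlgHom K (SU2LikeRel K a) (FreeAlgebra.ι K 0) ^ p.1 *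
      RingQuot.mkAlgHom K (SU2LikeRel K a) (FreeAlgebra.ι K 1) ^ p.2.1 *
      RingQuot.mkAlgHom K (SU2LikeRel K a) (FreeAlgebra.ι K 2) ^ p.2.2) = ⊤ := by
  set π := RingQuot.mkAlgHom K (SU2LikeRel K a) with hπ
  have hxy := RingQuot.mkAlgHom_rel K (SU2LikeRel.xy (K := K) (a := a))
  have hyz := RingQuot.mkAlgHom_rel K (SU2LikeRel.yz (K := K) (a := a))
  have hzx := RingQuot.mkAlgHom_rel K (SU2LikeRel.zx (K := K) (a := a))
  simp only [← hπ, map_add, map_mul, map_smul] at hxy hyz hzx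
  have hyx : π (FreeAlgebra.ι K 1) * π (FreeAlgebra.ι K 0) =
      a⁻¹ • (π (FreeAlgebra.ι K 0) * π (FreeAlgebra.ι K 1)) - a⁻¹ • π (FreeAlgebra.ι K 2) := by
    rw [hxy, smul_add, inv_smul_smul₀ ha, add_sub_cancel_right]
  have hzy : π (FreeAlgebra.ι K 2) * π (FreeAlgebra.ι K 1) =
      a⁻¹ • (π (FreeAlgebra.ι K 1) * π (FreeAlgebra.ι K 2)) - a⁻¹ • π (FreeAlgebra.ι K 0) := by
    rw [hyz, smul_add, inv_smul_smul₀ ha, add_sub_cancel_right]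
  set S := Submodule.span K (Set.range fun p : ℕ × ℕ × ℕ =>
    π (FreeAlgebra.ι K 0) ^ p.1 * π (FreeAlgebra.ι K 1) ^ p.2.1 * π (FreeAlgebra.ι K 2) ^ p.2.2)
  have hone : (1 : RingQuot (SU2LikeRel K a)) ∈ S :=
    Submodule.subset_span ⟨(0, 0, 0), by simp only [pow_zero, mul_one]⟩
  have key (f : FreeAlgebra K (Fin 3)) : ∀ v ∈ S, π f * v ∈ S := by
    induction f using FreeAlgebra.induction with
    | grade0 r =>
      intro v hv
      rw [AlgHom.commutes, ← Algebra.smul_def]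
      exact S.smul_mem r hv
    | grade1 i =>
      intro v hv
      refine mul_mem_span_monomials hyx hzy hzx ?_ hv
      fin_cases i
      · exact Or.inl rfl
      · exact Or.inr (Or.inl rfl)
      · exact Or.inr (Or.inr rfl)
    | mul f g hf hg =>
      intro v hv
      rw [map_mul, mul_assoc]
      exact hf _ (hg v hv)
    | add f g hf hg =>
      intro v hv
      rw [map_add, add_mul]
      exact add_mem (hf v hv) (hg v hv)
  refine Submodule.eq_top_iff'.2 fun u => ?_
  obtain ⟨f, rfl⟩ := RingQuot.mkAlgHom_surjective K (SU2LikeRel K a) u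
  simpa only [mul_one] using key f 1 hone

end SU2Like

/-- PBW property for the `su(2)`-like algebra with relations
`xy − a yx = z`, `yz − a zy = x`, `zx − a xz = y` (`a ≠ 0`): the images of the ordered
monomials `x^α y^β z^γ` form a `K`-basis. -/
theorem su2_like_pbw (K : Type*) [Field K] (a : K) (ha : a ≠ 0)
    (mono : ℕ × ℕ × ℕ → RingQuot (SU2LikeRel K a))
    (hmono : ∀ p : ℕ × ℕ × ℕ, mono p =
      RingQuot.mkAlgHom K (SU2LikeRel K a) (FreeAlgebra.ι K 0) ^ p.1 *
      RingQuot.mkAlgHom K (SU2LikeRel K a) (FreeAlgebra.ι K 1) ^ p.2.1 *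
      RingQuot.mkAlgHom K (SU2LikeRel K a) (FreeAlgebra.ι K 2) ^ p.2.2) :
    LinearIndependent K mono ∧ Submodule.span K (Set.range mono) = ⊤ := by
  obtain rfl : mono = _ := funext hmono
  exact ⟨SU2Like.linearIndependent_monomials a ha, SU2Like.span_monomials ha⟩
end
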